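/- Let {I₁,…,I_s} be a partition of {1,…,m} into nonempty blocks and {J₁,…,J_t} a partition of {1,…,n} into nonempty blocks, with every row of A and every column of B nonzero. Let σ_A > 0 satisfy ‖A (Aᵀ u)‖₂ ≥ σ_A ‖Aᵀ u‖₂ for every u ∈ ℝ^m, σ_B > 0 satisfy ‖Bᵀ (B v)‖₂ ≥ σ_B ‖B v‖₂ for every v ∈ ℝ^n, β_A > 0 satisfy ‖A_{I_i,:} x‖₂ ≤ β_A ‖A_{I_i,:}‖_F ‖x‖₂ for all i and x, and β_B > 0 satisfy ‖B_{:,J_j} c‖₂ ≤ β_B ‖B_{:,J_j}‖_F ‖c‖₂ for all j and c. Let η ∈ (0,2) and let X ∈ ℝ^{p×q} satisfy X − X* = Aᵀ W Bᵀ for some W ∈ ℝ^{m×n}. For each block pair (i,j), let R_{ij} = C_{I_i,J_j} − A_{I_i,:} X B_{:,J_j}, S_{ij} = (A_{I_i,:})ᵀ R_{ij} (B_{:,J_j})ᵀ / (‖A_{I_i,:}‖_F² ‖B_{:,J_j}‖_F²), and r_{ij} = ‖R_{ij}‖_F² / (‖A_{I_i,:}‖_F² ‖B_{:,J_j}‖_F²);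 define the adaptive-stepsize GRABK update X'_{(i,j)} = X + η (r_{ij}/‖S_{ij}‖_F²) S_{ij} when R_{ij} ≠ 0, and X'_{(i,j)} = X when R_{ij} = 0. Then ∑_{i=1}^s ∑_{j=1}^t (‖A_{I_i,:}‖_F² ‖B_{:,J_j}‖_F² / (‖A‖_F² ‖B‖_F²)) ‖X'_{(i,j)} − X*‖_F² ≤ (1 − η(2−η) σ_A² σ_B² / (‖A‖_F² β_A² ‖B‖_F² β_B²)) ‖X − X*‖_F². -/

import Mathlib

open Matrix

noncomputable def vecNormSq {α : Type*} [Fintype α] (x : α → ℝ) : ℝ := ∑ i, (x i) ^ 2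

noncomputable def vecNorm {α : Type*} [Fintype α] (x : α → ℝ) : ℝ := Real.sqrt (vecNormSq x)

noncomputable def frobNormSq {α β : Type*} [Fintype α] [Fintype β] (M : Matrix α β ℝ) : ℝ :=
  ∑ i, ∑ j, (M i j) ^ 2

noncomputable def frobNorm {α β : Type*} [Fintype α] [Fintype β] (M : Matrix α β ℝ) : ℝ :=
  Real.sqrt (frobNormSq M)

noncomputable def frobInner {α β : Type*} [Fintype α] [Fintype β] (U V : Matrix α β ℝ) : ℝ :=
  ∑ i, ∑ j, U i j * V i j

def IsMPInv {α β : Type*} [Fintype α] [Fintype β] (M : Matrix α β ℝ) (P : Matrix β α ℝ) : Prop :=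
  M * P * M = M ∧ P * M * P = P ∧ (M * P)ᵀ = M * P ∧ (P * M)ᵀ = P * M

def rowSub {m p : ℕ} (A : Matrix (Fin m) (Fin p) ℝ) (I : Finset (Fin m)) :
    Matrix {i // i ∈ I} (Fin p) ℝ := A.submatrix Subtype.val id

def colSub {q n : ℕ} (B : Matrix (Fin q) (Fin n) ℝ) (J : Finset (Fin n)) :
    Matrix (Fin q) {j // j ∈ J} ℝ := B.submatrix id Subtype.val

def subMat {m n : ℕ} (C : Matrix (Fin m) (Fin n) ℝ) (I : Finset (Fin m)) (J : Finset (Fin n)) :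
    Matrix {i // i ∈ I} {j // j ∈ J} ℝ := C.submatrix Subtype.val Subtype.val

noncomputable def bilin {m p q n : ℕ} (A : Matrix (Fin m) (Fin p) ℝ) (B : Matrix (Fin q) (Fin n) ℝ)
    (X : Matrix (Fin p) (Fin q) ℝ) (i : Fin m) (j : Fin n) : ℝ :=
  ∑ a, ∑ b, A i a * X a b * B b j

def rank1 {m p q n : ℕ} (A : Matrix (Fin m) (Fin p) ℝ) (B : Matrix (Fin q) (Fin n) ℝ)
    (i : Fin m) (j : Fin n) (s : ℝ) : Matrix (Fin p) (Fin q) ℝ :=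
  Matrix.of fun a b => A i a * s * B b j

noncomputable def rowSubNorm {m p : ℕ} (A : Matrix (Fin m) (Fin p) ℝ) (I : Finset (Fin m)) :
    Matrix {i // i ∈ I} (Fin p) ℝ := Matrix.of fun i a => A i.val a / vecNorm (A i.val)

noncomputable def colSubNorm {q n : ℕ} (B : Matrix (Fin q) (Fin n) ℝ) (J : Finset (Fin n)) :
    Matrix (Fin q) {j // j ∈ J} ℝ :=
  Matrix.of fun b j => B b j.val / vecNorm (fun b' => B b' j.val)

lemma gk_vec_nonneg {α : Type*} [Fintype α] (x : α → ℝ) : 0 ≤ vecNormSq x :=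
  Finset.sum_nonneg fun _ _ => sq_nonneg _

lemma gk_frob_nonneg {α β : Type*} [Fintype α] [Fintype β] (M : Matrix α β ℝ) :
    0 ≤ frobNormSq M :=
  Finset.sum_nonneg fun _ _ => Finset.sum_nonneg fun _ _ => sq_nonneg _

lemma gk_vecNorm_sq {α : Type*} [Fintype α] (x : α → ℝ) : vecNorm x ^ 2 = vecNormSq x :=
  Real.sq_sqrt (gk_vec_nonneg x)

lemma gk_frobNorm_sq {α β : Type*} [Fintype α] [Fintype β] (M : Matrix α β ℝ) :
    frobNorm M ^ 2 = frobNormSq M :=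
  Real.sq_sqrt (gk_frob_nonneg M)

lemma gk_frob_cols {α β : Type*} [Fintype α] [Fintype β] (M : Matrix α β ℝ) :
    frobNormSq M = ∑ j, vecNormSq (fun i => M i j) := by
  unfold frobNormSq vecNormSq
  exact Finset.sum_comm

lemma gk_frob_transpose {α β : Type*} [Fintype α] [Fintype β] (M : Matrix α β ℝ) :
    frobNormSq Mᵀ = frobNormSq M := by
  unfold frobNormSq
  exact Finset.sum_comm

lemma gk_col_mul {α β γ : Type*} [Fintype α] [Fintype β] [Fintype γ] (M : Matrix α β ℝ)
    (N : Matrix β γ ℝ) (j : γ) : (fun i => (M * N) i j) = M.mulVec (fun i => N i j) := by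
  ext i
  simp [Matrix.mul_apply, Matrix.mulVec, dotProduct]

lemma gk_mul_le {α β γ : Type*} [Fintype α] [Fintype β] [Fintype γ] (M : Matrix α β ℝ)
    (N : Matrix β γ ℝ) (c : ℝ) (h : ∀ x, vecNormSq (M.mulVec x) ≤ c * vecNormSq x) :
    frobNormSq (M * N) ≤ c * frobNormSq N := by
  rw [gk_frob_cols, gk_frob_cols, Finset.mul_sum]
  refine Finset.sum_le_sum fun j _ => ?_
  rw [gk_col_mul]
  exact h _

lemma gk_le_mul {α β γ : Type*} [Fintype α] [Fintype β] [Fintype γ] (M : Matrix α β ℝ)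
    (N : Matrix α γ ℝ) (c : ℝ)
    (h : ∀ x, c * vecNormSq (Mᵀ.mulVec x) ≤ vecNormSq (M.mulVec (Mᵀ.mulVec x))) :
    c * frobNormSq (Mᵀ * N) ≤ frobNormSq (M * (Mᵀ * N)) := by
  rw [gk_frob_cols, gk_frob_cols, Finset.mul_sum]
  refine Finset.sum_le_sum fun j _ => ?_
  rw [gk_col_mul, gk_col_mul]
  exact h _

lemma gk_vec_dot {α : Type*} [Fintype α] (x : α → ℝ) : vecNormSq x = x ⬝ᵥ x := by
  simp [vecNormSq, dotProduct, sq]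

lemma gk_transpose_bound {α β : Type*} [Fintype α] [Fintype β] (M : Matrix α β ℝ) (c : ℝ)
    (h : ∀ x, vecNormSq (M.mulVec x) ≤ c * vecNormSq x) (hc : 0 ≤ c) (y : α → ℝ) :
    vecNormSq (Mᵀ.mulVec y) ≤ c * vecNormSq y := by
  set z := Mᵀ.mulVec y with hz
  have h1 : vecNormSq z = y ⬝ᵥ M.mulVec z := by
    rw [gk_vec_dot]
    conv_lhs => rw [hz]
    rw [Matrix.mulVec_transpose, ← Matrix.dotProduct_mulVec, hz, Matrix.mulVec_transpose]
  have h2 : (y ⬝ᵥ M.mulVec z) ^ 2 ≤ vecNormSq y * vecNormSq (M.mulVec z) :=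
    Finset.sum_mul_sq_le_sq_mul_sq _ _ _
  have h3 := h z
  have hy := gk_vec_nonneg y
  have h4 := mul_le_mul_of_nonneg_left h3 hy
  rw [← h1] at h2
  rcases (gk_vec_nonneg z).eq_or_lt with h0 | h0
  · rw [← h0]; positivity
  · nlinarith

lemma gk_inner_trace {α β : Type*} [Fintype α] [Fintype β] (U V : Matrix α β ℝ) :
    frobInner U V = (Uᵀ * V).trace := by
  unfold frobInner
  rw [Finset.sum_comm]
  simp [Matrix.trace, Matrix.mul_apply]

lemma gk_inner_adj {α β γ δ : Type*} [Fintype α] [Fintype β] [Fintype γ] [Fintype δ]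
    (U : Matrix α β ℝ) (E : Matrix β γ ℝ) (V : Matrix γ δ ℝ) (R : Matrix α δ ℝ) :
    frobInner (Uᵀ * R * Vᵀ) E = frobInner R (U * E * V) := by
  rw [gk_inner_trace, gk_inner_trace]
  simp only [Matrix.transpose_mul, Matrix.transpose_transpose, Matrix.mul_assoc]
  rw [Matrix.trace_mul_comm]
  simp only [Matrix.mul_assoc]

lemma gk_frob_add_smul {α β : Type*} [Fintype α] [Fintype β] (E S : Matrix α β ℝ) (c : ℝ) :
    frobNormSq (E + c • S) = frobNormSq E + 2 * c * frobInner S E + c ^ 2 * frobNormSq S := by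
  unfold frobNormSq frobInner
  simp only [Finset.mul_sum, ← Finset.sum_add_distrib]
  refine Finset.sum_congr rfl fun i _ => Finset.sum_congr rfl fun j _ => ?_
  simp only [Matrix.add_apply, Matrix.smul_apply, smul_eq_mul]
  ring

lemma gk_frob_smul {α β : Type*} [Fintype α] [Fintype β] (S : Matrix α β ℝ) (c : ℝ) :
    frobNormSq (c • S) = c ^ 2 * frobNormSq S := by
  unfold frobNormSq
  simp only [Finset.mul_sum, Matrix.smul_apply, smul_eq_mul, mul_pow]

lemma gk_inner_smul {α β : Type*} [Fintype α] [Fintype β] (S E : Matrix α β ℝ) (c : ℝ) :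
    frobInner (c • S) E = c * frobInner S E := by
  unfold frobInner
  simp only [Finset.mul_sum, Matrix.smul_apply, smul_eq_mul, mul_assoc]

lemma gk_inner_neg {α β : Type*} [Fintype α] [Fintype β] (S : Matrix α β ℝ) :
    frobInner S (-S) = - frobNormSq S := by
  unfold frobInner frobNormSq
  simp [← Finset.sum_neg_distrib, sq]

lemma gk_frob_neg {α β : Type*} [Fintype α] [Fintype β] (S : Matrix α β ℝ) :
    frobNormSq (-S) = frobNormSq S := by
  simp [frobNormSq]

lemma gk_frob_pos {α β : Type*} [Fintype α] [Fintype β] (S : Matrix α β ℝ) (h : S ≠ 0) :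
    0 < frobNormSq S := by
  refine lt_of_le_of_ne (gk_frob_nonneg S) fun h0 => h ?_
  ext i j
  have h1 := (Finset.sum_eq_zero_iff_of_nonneg
    (fun i _ => Finset.sum_nonneg fun j _ => sq_nonneg (S i j))).1 h0.symm i (Finset.mem_univ i)
  have h2 := (Finset.sum_eq_zero_iff_of_nonneg
    (fun j _ => sq_nonneg (S i j))).1 h1 j (Finset.mem_univ j)
  simpa using h2

lemma gk_part {m s : ℕ} (Ib : Fin s → Finset (Fin m)) (h : ∀ i : Fin m, ∃! a, i ∈ Ib a)
    (f : Fin m → ℝ) : ∑ a, ∑ i : {i // i ∈ Ib a}, f i = ∑ i, f i := by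
  have h1 : ∀ a, ∑ i : {i // i ∈ Ib a}, f i = ∑ i, if i ∈ Ib a then f i else 0 := by
    intro a
    rw [Finset.sum_coe_sort (Ib a) f]
    simp
  simp only [h1]
  rw [Finset.sum_comm]
  refine Finset.sum_congr rfl fun i _ => ?_
  obtain ⟨a, ha, hu⟩ := h i
  rw [Finset.sum_eq_single a]
  · simp [ha]
  · intro b _ hb
    rw [if_neg]
    exact fun hb' => hb (hu b hb')
  · simp

lemma gk_upper {x c v : ℝ} (hx : 0 ≤ x) (h : x ≤ c * v) : x ^ 2 ≤ c ^ 2 * v ^ 2 := by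
  rw [← mul_pow]
  exact pow_le_pow_left₀ hx h 2

lemma gk_vecNorm_nonneg {α : Type*} [Fintype α] (x : α → ℝ) : 0 ≤ vecNorm x :=
  Real.sqrt_nonneg _

/-- one-step expected error bound for the GRABK method with adaptive
stepsize `α = η L`, partition sampling, and the compact weighted direction `S_{ij}`. -/
theorem grabk_adaptive_step_expected_error {m p q n s t : ℕ}
    (A : Matrix (Fin m) (Fin p) ℝ) (B : Matrix (Fin q) (Fin n) ℝ)
    (Xs : Matrix (Fin p) (Fin q) ℝ) (C : Matrix (Fin m) (Fin n) ℝ) (hC : C = A * Xs * B)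
    (Ib : Fin s → Finset (Fin m)) (Jb : Fin t → Finset (Fin n))
    (hIne : ∀ a, (Ib a).Nonempty) (hJne : ∀ b, (Jb b).Nonempty)
    (hIpart : ∀ i : Fin m, ∃! a, i ∈ Ib a) (hJpart : ∀ j : Fin n, ∃! b, j ∈ Jb b)
    (hAnz : ∀ i, A i ≠ 0) (hBnz : ∀ j, (fun b => B b j) ≠ 0)
    (σA σB βA βB : ℝ) (hσA : 0 < σA) (hσB : 0 < σB) (hβA : 0 < βA) (hβB : 0 < βB)
    (hA : ∀ u : Fin m → ℝ, σA * vecNorm (Aᵀ.mulVec u) ≤ vecNorm (A.mulVec (Aᵀ.mulVec u)))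
    (hB : ∀ v : Fin n → ℝ, σB * vecNorm (B.mulVec v) ≤ vecNorm (Bᵀ.mulVec (B.mulVec v)))
    (hβA2 : ∀ a, ∀ x : Fin p → ℝ,
      vecNorm ((rowSub A (Ib a)).mulVec x) ≤ βA * frobNorm (rowSub A (Ib a)) * vecNorm x)
    (hβB2 : ∀ b, ∀ c : {j // j ∈ Jb b} → ℝ,
      vecNorm ((colSub B (Jb b)).mulVec c) ≤ βB * frobNorm (colSub B (Jb b)) * vecNorm c)
    (η : ℝ) (hη : 0 < η) (hη2 : η < 2)
    (X : Matrix (Fin p) (Fin q) ℝ) (W : Matrix (Fin m) (Fin n) ℝ)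
    (hX : X - Xs = Aᵀ * W * Bᵀ)
    (R : ∀ a b, Matrix {i // i ∈ Ib a} {j // j ∈ Jb b} ℝ)
    (hR : ∀ a b, R a b = subMat C (Ib a) (Jb b) - rowSub A (Ib a) * X * colSub B (Jb b))
    (S : Fin s → Fin t → Matrix (Fin p) (Fin q) ℝ)
    (hS : ∀ a b, S a b =
      (1 / (frobNormSq (rowSub A (Ib a)) * frobNormSq (colSub B (Jb b)))) •
        ((rowSub A (Ib a))ᵀ * R a b * (colSub B (Jb b))ᵀ))
    (r : Fin s → Fin t → ℝ)
    (hr : ∀ a b, r a b =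
      frobNormSq (R a b) / (frobNormSq (rowSub A (Ib a)) * frobNormSq (colSub B (Jb b))))
    (X' : Fin s → Fin t → Matrix (Fin p) (Fin q) ℝ)
    (hX'1 : ∀ a b, R a b ≠ 0 →
      X' a b = X + (η * (r a b / frobNormSq (S a b))) • S a b)
    (hX'2 : ∀ a b, R a b = 0 → X' a b = X) :
    ∑ a, ∑ b,
        (frobNormSq (rowSub A (Ib a)) * frobNormSq (colSub B (Jb b)) /
            (frobNormSq A * frobNormSq B)) * frobNormSq (X' a b - Xs)
      ≤ (1 - η * (2 - η) * σA ^ 2 * σB ^ 2 /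
            (frobNormSq A * βA ^ 2 * frobNormSq B * βB ^ 2)) * frobNormSq (X - Xs) := by
  set E := X - Xs with hE
  -- trivial cases
  rcases Nat.eq_zero_or_pos m with hm | hm
  · subst hm
    have hs : IsEmpty (Fin s) := ⟨fun a => (hIne a).elim fun i _ => i.elim0⟩
    have hE0 : frobNormSq E = 0 := by
      have : E = 0 := by
        rw [hX]; ext i j; simp [Matrix.mul_apply]
      rw [this]; simp [frobNormSq]
    rw [hE0]
    simp
  rcases Nat.eq_zero_or_pos n with hn | hn
  · subst hn
    have hs : IsEmpty (Fin t) := ⟨fun a => (hJne a).elim fun i _ => i.elim0⟩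
    have hE0 : frobNormSq E = 0 := by
      have : E = 0 := by
        rw [hX]; ext i j; simp [Matrix.mul_apply]
      rw [this]; simp [frobNormSq]
    rw [hE0]
    simp
  have hAp : 0 < frobNormSq A := gk_frob_pos A fun h => hAnz ⟨0, hm⟩ (by rw [h]; rfl)
  have hBp : 0 < frobNormSq B := gk_frob_pos B fun h => hBnz ⟨0, hn⟩ (by rw [h]; rfl)
  have hap : ∀ a, 0 < frobNormSq (rowSub A (Ib a)) := by
    intro a
    obtain ⟨i, hi⟩ := hIne a
    refine gk_frob_pos _ fun h => hAnz i ?_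
    ext k
    exact congrFun (congrFun h ⟨i, hi⟩) k
  have hbp : ∀ b, 0 < frobNormSq (colSub B (Jb b)) := by
    intro b
    obtain ⟨j, hj⟩ := hJne b
    refine gk_frob_pos _ fun h => hBnz j ?_
    ext k
    exact congrFun (congrFun h k) ⟨j, hj⟩
  have hsa : ∑ a, frobNormSq (rowSub A (Ib a)) = frobNormSq A :=
    gk_part Ib hIpart fun i => ∑ j, (A i j) ^ 2
  have hsb : ∑ b, frobNormSq (colSub B (Jb b)) = frobNormSq B := by
    simp only [gk_frob_cols]
    exact gk_part Jb hJpart fun j => vecNormSq fun i => B i j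
  -- residuals
  have hRE : ∀ a b, rowSub A (Ib a) * E * colSub B (Jb b) = - R a b := by
    intro a b
    have : subMat C (Ib a) (Jb b) = rowSub A (Ib a) * Xs * colSub B (Jb b) := by
      rw [hC]; rfl
    rw [hR, this, hE, Matrix.mul_sub, Matrix.sub_mul, neg_sub]
  have hsR : ∑ a, ∑ b, frobNormSq (R a b) = frobNormSq (A * E * B) := by
    have h1 : ∀ a b, frobNormSq (R a b) =
        ∑ i : {i // i ∈ Ib a}, ∑ j : {j // j ∈ Jb b}, ((A * E * B) i j) ^ 2 := by
      intro a b
      rw [← gk_frob_neg, ← hRE]; rfl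
    simp only [h1]
    have h2 : ∀ a, ∑ b, ∑ i : {i // i ∈ Ib a}, ∑ j : {j // j ∈ Jb b}, ((A * E * B) i j) ^ 2
        = ∑ i : {i // i ∈ Ib a}, ∑ j, ((A * E * B) i j) ^ 2 := by
      intro a
      rw [Finset.sum_comm]
      exact Finset.sum_congr rfl fun i _ => gk_part Jb hJpart fun j => ((A * E * B) i j) ^ 2
    simp only [h2]
    exact gk_part Ib hIpart fun i => ∑ j, ((A * E * B) i j) ^ 2
  -- lower bound
  have hlow : σA ^ 2 * σB ^ 2 * frobNormSq E ≤ frobNormSq (A * E * B) := by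
    have h1 : σA ^ 2 * frobNormSq (E * B) ≤ frobNormSq (A * E * B) := by
      have := gk_le_mul A (W * Bᵀ * B) (σA ^ 2) fun x => by
        have := gk_upper (mul_nonneg hσA.le (gk_vecNorm_nonneg _)) (c := 1) (by simpa using hA x)
        simpa [mul_pow, gk_vecNorm_sq] using this
      rw [hX]
      simpa only [Matrix.mul_assoc] using this
    have h2 : σB ^ 2 * frobNormSq E ≤ frobNormSq (E * B) := by
      have := gk_le_mul Bᵀ (Wᵀ * A) (σB ^ 2) fun x => by
        have := gk_upper (mul_nonneg hσB.le (gk_vecNorm_nonneg _)) (c := 1) (by simpa using hB x)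
        simpa [mul_pow, gk_vecNorm_sq] using this
      rw [← gk_frob_transpose E, ← gk_frob_transpose (E * B), hX]
      simpa only [Matrix.mul_assoc, Matrix.transpose_mul, Matrix.transpose_transpose] using this
    have h3 := mul_le_mul_of_nonneg_left h2 (sq_nonneg σA)
    linarith
  -- per-block estimate
  have hblock : ∀ a b, frobNormSq (rowSub A (Ib a)) * frobNormSq (colSub B (Jb b)) *
      frobNormSq (X' a b - Xs) ≤
      frobNormSq (rowSub A (Ib a)) * frobNormSq (colSub B (Jb b)) * frobNormSq E
        - η * (2 - η) / (βA ^ 2 * βB ^ 2) * frobNormSq (R a b) := by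
    intro a b
    by_cases h0 : R a b = 0
    · rw [hX'2 a b h0, h0]
      simp [frobNormSq, hE]
    have hRp := gk_frob_pos _ h0
    have hin : frobInner (S a b) E = - r a b := by
      rw [hS, gk_inner_smul, gk_inner_adj, hRE, gk_inner_neg, hr]
      ring
    have hrp : 0 < r a b := by
      rw [hr]; exact div_pos hRp (mul_pos (hap a) (hbp b))
    have hSp : 0 < frobNormSq (S a b) := by
      refine gk_frob_pos _ fun h => ?_
      rw [h] at hin
      simp [frobInner] at hin
      exact hrp.ne' hin
    have hSle : frobNormSq (S a b) ≤ βA ^ 2 * βB ^ 2 * r a b := by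
      have e1 := gk_mul_le (rowSub A (Ib a))ᵀ (R a b * (colSub B (Jb b))ᵀ)
        (βA ^ 2 * frobNormSq (rowSub A (Ib a)))
        (gk_transpose_bound _ _ (fun x => by
          have := gk_upper (gk_vecNorm_nonneg _) (hβA2 a x)
          simpa only [mul_pow, gk_vecNorm_sq, gk_frobNorm_sq] using this)
          (mul_nonneg (sq_nonneg _) (hap a).le))
      have e2 := gk_mul_le (colSub B (Jb b)) (R a b)ᵀ
        (βB ^ 2 * frobNormSq (colSub B (Jb b))) (fun x => by
          have := gk_upper (gk_vecNorm_nonneg _) (hβB2 b x)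
          simpa only [mul_pow, gk_vecNorm_sq, gk_frobNorm_sq] using this)
      rw [gk_frob_transpose, ← gk_frob_transpose, Matrix.transpose_mul,
        Matrix.transpose_transpose] at e2
      rw [hS, gk_frob_smul, hr, Matrix.mul_assoc]
      have ha := hap a
      have hb := hbp b
      have e3 := mul_le_mul_of_nonneg_left e2 (mul_nonneg (sq_nonneg βA) ha.le)
      have e4 := e1.trans e3
      refine (mul_le_mul_of_nonneg_left e4 (sq_nonneg _)).trans (le_of_eq ?_)
      field_simp
    have hkey : frobNormSq (X' a b - Xs) =
        frobNormSq E - η * (2 - η) * (r a b ^ 2 / frobNormSq (S a b)) := by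
      have : X' a b - Xs = E + (η * (r a b / frobNormSq (S a b))) • S a b := by
        rw [hX'1 a b h0, hE]; abel
      rw [this, gk_frob_add_smul, hin]
      field_simp
      ring
    have hq : r a b / (βA ^ 2 * βB ^ 2) ≤ r a b ^ 2 / frobNormSq (S a b) := by
      rw [div_le_div_iff₀ (by positivity) hSp]
      nlinarith
    have hrr : frobNormSq (R a b) =
        frobNormSq (rowSub A (Ib a)) * frobNormSq (colSub B (Jb b)) * r a b := by
      rw [hr]
      have ha := (hap a).ne'
      have hb := (hbp b).ne'
      field_simp
    rw [hkey, hrr, mul_sub]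
    have hη3 : 0 ≤ η * (2 - η) := mul_nonneg hη.le (by linarith)
    have h5 := mul_le_mul_of_nonneg_left (mul_le_mul_of_nonneg_left hq hη3)
      (mul_pos (hap a) (hbp b)).le
    have h6 : η * (2 - η) / (βA ^ 2 * βB ^ 2) *
        (frobNormSq (rowSub A (Ib a)) * frobNormSq (colSub B (Jb b)) * r a b) =
        frobNormSq (rowSub A (Ib a)) * frobNormSq (colSub B (Jb b)) *
          (η * (2 - η) * (r a b / (βA ^ 2 * βB ^ 2))) := by ring
    rw [h6]
    linarith
  have hsum := Finset.sum_le_sum fun a (_ : a ∈ Finset.univ) =>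
    Finset.sum_le_sum fun b (_ : b ∈ Finset.univ) => hblock a b
  simp only [Finset.sum_sub_distrib, ← Finset.mul_sum, ← Finset.sum_mul] at hsum
  rw [hsR, hsa, hsb] at hsum
  have hfin : ∑ a, ∑ b,
        (frobNormSq (rowSub A (Ib a)) * frobNormSq (colSub B (Jb b)) /
            (frobNormSq A * frobNormSq B)) * frobNormSq (X' a b - Xs) =
      (∑ a, ∑ b, frobNormSq (rowSub A (Ib a)) * frobNormSq (colSub B (Jb b)) *
        frobNormSq (X' a b - Xs)) / (frobNormSq A * frobNormSq B) := by
    simp only [Finset.sum_div]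
    refine Finset.sum_congr rfl fun a _ => Finset.sum_congr rfl fun b _ => ?_
    ring
  rw [hfin, div_le_iff₀ (mul_pos hAp hBp)]
  have hc : 0 ≤ η * (2 - η) / (βA ^ 2 * βB ^ 2) :=
    div_nonneg (mul_nonneg hη.le (by linarith)) (by positivity)
  have h7 := mul_le_mul_of_nonneg_left hlow hc
  refine (hsum.trans (sub_le_sub_left h7 _)).trans (le_of_eq ?_)
  field_simp
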